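/- Work in ℝ⁴ (n = 4). For every valid list ⟨a₁,…,a_k⟩ over {1,2,3,4} with k ≥ 1, the open simplex whose vertices are the columns of the identity matrix (the open standard simplex) is disjoint from the open simplex whose vertices are the columns of N_k = M_{a₁}·M_{a₂}⋯M_{a_k}. (This is the geometric core of the theorem that the 4-orthoplex is all-net: along any chain of facets in any ridge unfolding of the 4-orthoplex, the first and last facets do not overlap.) -/

import Mathlib

/-- The reflection matrix `M_a` for `n = 4` (0-indexed): the identity except that the
`a`-th column has `-1` in the `a`-th entry and `2/3` in every other entry. -/
noncomputable def reflMat4 (a : Fin 4) : Matrix (Fin 4) (Fin 4) ℝ :=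
  fun i j => if j = a then (if i = a then -1 else 2 / 3) else if i = j then 1 else 0

/-- A list over `{1,…,n}` (as `Fin n`) is valid if no nonempty block of consecutive entries
has every value occurring an even number of times (equivalently, it encodes a self-avoiding
path on the 1-skeleton of the `n`-cube). -/
def IsValidList {n : ℕ} (l : List (Fin n)) : Prop :=
  ∀ j k : ℕ, j < k → k ≤ l.length →
    ¬ ∀ m : Fin n, Even (((l.drop j).take (k - j)).count m)

/-- The open simplex on the columns of a matrix `A`: all points `A ⬝ c` where `c` has
strictly positive coordinates summing to `1`. -/
def openSimplexOf (A : Matrix (Fin 4) (Fin 4) ℝ) : Set (Fin 4 → ℝ) :=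
  {x | ∃ c : Fin 4 → ℝ, (∀ i, 0 < c i) ∧ (∑ i, c i = 1) ∧ x = A.mulVec c}

/-- Three times the row vector `h * M_a`. -/
def rowStep (h : Fin 4 → ℤ) (a : Fin 4) : Fin 4 → ℤ :=
  fun i => if i = a then 2 * ∑ j, h j - 5 * h a else 3 * h i

/-- A nonnegative nonzero integer functional is nonpositive on all columns of the product of
the reflection matrices along `l`. -/
def IsSeparated (l : List (Fin 4)) : Prop :=
  ∃ h : Fin 4 → ℤ, (∀ i, 0 ≤ h i) ∧ (∃ i, 0 < h i) ∧ ∀ i, l.foldl rowStep h i ≤ 0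

lemma vecMul_reflMat4 (h : Fin 4 → ℤ) (a i : Fin 4) :
    3 * Matrix.vecMul (fun j => (h j : ℝ)) (reflMat4 a) i = (rowStep h a i : ℝ) := by
  fin_cases a <;> fin_cases i <;>
    simp [Matrix.vecMul, dotProduct, reflMat4, rowStep, Fin.sum_univ_four] <;> ring

lemma vecMul_prod_reflMat4 (l : List (Fin 4)) (h : Fin 4 → ℤ) :
    (3 : ℝ) ^ l.length • Matrix.vecMul (fun j => (h j : ℝ)) (l.map reflMat4).prod =
      fun i => (l.foldl rowStep h i : ℝ) := by
  induction l generalizing h with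
  | nil => simp
  | cons a l ih =>
    have hstep : (3 : ℝ) • Matrix.vecMul (fun j => (h j : ℝ)) (reflMat4 a) =
        fun j => (rowStep h a j : ℝ) := funext (vecMul_reflMat4 h a)
    rw [List.foldl_cons, ← ih, ← hstep, List.map_cons, List.prod_cons, List.length_cons,
      ← Matrix.vecMul_vecMul, Matrix.smul_vecMul, smul_smul, pow_succ]

lemma IsSeparated.disjoint {l : List (Fin 4)} (hl : IsSeparated l) :
    Disjoint (openSimplexOf (1 : Matrix (Fin 4) (Fin 4) ℝ))
      (openSimplexOf ((l.map reflMat4).prod)) := by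
  obtain ⟨h, hnonneg, ⟨i, hi⟩, hle⟩ := hl
  rw [Set.disjoint_left]
  rintro x ⟨c, hc, -, hxc⟩ ⟨d, hd, -, hxd⟩
  rw [Matrix.one_mulVec] at hxc
  have hpos : 0 < (fun j => (h j : ℝ)) ⬝ᵥ x := by
    rw [hxc]
    exact Finset.sum_pos' (fun j _ => mul_nonneg (Int.cast_nonneg (hnonneg j)) (hc j).le)
      ⟨i, Finset.mem_univ i, mul_pos (Int.cast_pos.2 hi) (hc i)⟩
  have hnonpos : (3 : ℝ) ^ l.length * ((fun j => (h j : ℝ)) ⬝ᵥ x) ≤ 0 := by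
    rw [hxd, Matrix.dotProduct_mulVec, ← smul_eq_mul, ← smul_dotProduct,
      vecMul_prod_reflMat4]
    exact Finset.sum_nonpos fun j _ =>
      mul_nonpos_of_nonpos_of_nonneg (Int.cast_nonpos.2 (hle j)) (hd j).le
  exact absurd (mul_pos (by positivity) hpos) hnonpos.not_gt

lemma rowStep_comp (σ : Equiv.Perm (Fin 4)) (h : Fin 4 → ℤ) (a : Fin 4) :
    rowStep (h ∘ σ) a = rowStep h (σ a) ∘ σ := by
  ext i
  simp [rowStep, Equiv.sum_comp σ h]

lemma foldl_rowStep_comp (σ : Equiv.Perm (Fin 4)) (l : List (Fin 4)) (h : Fin 4 → ℤ) :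
    l.foldl rowStep (h ∘ σ) = (l.map σ).foldl rowStep h ∘ σ := by
  induction l generalizing h with
  | nil => rfl
  | cons a l ih => rw [List.foldl_cons, rowStep_comp, ih, List.map_cons, List.foldl_cons]

lemma IsSeparated.of_map {σ : Equiv.Perm (Fin 4)} {l : List (Fin 4)}
    (hl : IsSeparated (l.map σ)) : IsSeparated l := by
  obtain ⟨h, hnonneg, ⟨i, hi⟩, hle⟩ := hl
  refine ⟨h ∘ σ, fun j => hnonneg (σ j), ⟨σ.symm i, by simpa using hi⟩, fun j => ?_⟩
  rw [foldl_rowStep_comp]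
  exact hle (σ j)

lemma IsValidList.map {n : ℕ} {l : List (Fin n)} (hl : IsValidList l)
    (σ : Equiv.Perm (Fin n)) : IsValidList (l.map σ) := by
  intro j k hjk hk heven
  refine hl j k hjk (by simpa using hk) fun m => ?_
  have := heven (σ m)
  rwa [← List.map_drop, ← List.map_take, List.count_map_of_injective _ _ σ.injective] at this

/-- The vertex of the cube, as a bit mask, reached from the origin along `l`. -/
def cubeVertex : List (Fin 4) → ℕ
  | [] => 0
  | a :: l => 2 ^ (a : ℕ) ^^^ cubeVertex l

lemma cubeVertex_append (l m : List (Fin 4)) :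
    cubeVertex (l ++ m) = cubeVertex l ^^^ cubeVertex m := by
  induction l with
  | nil => simp [cubeVertex]
  | cons a l ih => simp [cubeVertex, ih, Nat.xor_assoc]

lemma testBit_cubeVertex (l : List (Fin 4)) (m : Fin 4) :
    (cubeVertex l).testBit m = decide (Odd (l.count m)) := by
  induction l with
  | nil => simp [cubeVertex]
  | cons a l ih =>
    rw [cubeVertex, Nat.testBit_xor, ih, Nat.testBit_two_pow, List.count_cons]
    by_cases h : a = m
    · simp [h, Nat.odd_add_one, ← Nat.not_even_iff_odd]
    · simp [h, Fin.val_inj]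

lemma even_count_of_cubeVertex_eq_zero {l : List (Fin 4)} (hl : cubeVertex l = 0)
    (m : Fin 4) : Even (l.count m) := by
  have := testBit_cubeVertex l m
  rw [hl] at this
  simpa using this

lemma IsValidList.cubeVertex_take_ne {p l : List (Fin 4)} {a : Fin 4}
    (hval : IsValidList (p ++ a :: l)) {j : ℕ} (hj : j ≤ p.length) :
    cubeVertex (p.take j) ≠ cubeVertex (p ++ [a]) := by
  intro heq
  refine hval j (p.length + 1) (by omega) (by simp) fun m =>
    even_count_of_cubeVertex_eq_zero ?_ m
  have hblock : ((p ++ a :: l).drop j).take (p.length + 1 - j) = p.drop j ++ [a] := by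
    rw [List.drop_append_of_le_length hj, List.take_append]
    have : p.length + 1 - j - (p.length - j) = 1 := by omega
    simp [this]
    omega
  rw [hblock]
  have hsplit : cubeVertex (p ++ [a]) =
      cubeVertex (p.take j) ^^^ cubeVertex (p.drop j ++ [a]) := by
    rw [← cubeVertex_append, ← List.append_assoc, List.take_append_drop]
  rw [← heq] at hsplit
  have := congrArg (cubeVertex (p.take j) ^^^ ·) hsplit
  simpa [← Nat.xor_assoc] using this.symm

/-- An integer row vector with explicit entries, suited to evaluation. -/
structure IntRow where
  /-- The entry at index `0`. -/
  x : ℤ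
  /-- The entry at index `1`. -/
  y : ℤ
  /-- The entry at index `2`. -/
  z : ℤ
  /-- The entry at index `3`. -/
  w : ℤ

namespace IntRow

/-- The row as a function. -/
def toFun (r : IntRow) : Fin 4 → ℤ := ![r.x, r.y, r.z, r.w]

/-- The counterpart of `rowStep`. -/
def step : IntRow → Fin 4 → IntRow
  | ⟨x, y, z, w⟩, 0 => ⟨2 * (y + z + w) - 3 * x, 3 * y, 3 * z, 3 * w⟩
  | ⟨x, y, z, w⟩, 1 => ⟨3 * x, 2 * (x + z + w) - 3 * y, 3 * z, 3 * w⟩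
  | ⟨x, y, z, w⟩, 2 => ⟨3 * x, 3 * y, 2 * (x + y + w) - 3 * z, 3 * w⟩
  | ⟨x, y, z, w⟩, 3 => ⟨3 * x, 3 * y, 3 * z, 2 * (x + y + z) - 3 * w⟩

/-- Whether all entries are nonpositive. -/
def nonpos (r : IntRow) : Bool :=
  decide (r.x ≤ 0) && decide (r.y ≤ 0) && decide (r.z ≤ 0) && decide (r.w ≤ 0)

lemma toFun_step (r : IntRow) (a : Fin 4) : (r.step a).toFun = rowStep r.toFun a := by
  ext i
  fin_cases a <;> fin_cases i <;>
    simp [step, toFun, rowStep, Fin.sum_univ_four] <;> ring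

lemma toFun_foldl_step (r : IntRow) (l : List (Fin 4)) :
    (l.foldl step r).toFun = l.foldl rowStep r.toFun := by
  induction l generalizing r with
  | nil => rfl
  | cons a l ih => rw [List.foldl_cons, ih, toFun_step, List.foldl_cons]

lemma toFun_nonpos {r : IntRow} (hr : r.nonpos = true) (i : Fin 4) : r.toFun i ≤ 0 := by
  simp only [nonpos, Bool.and_eq_true, decide_eq_true_eq] at hr
  fin_cases i <;> simp [toFun, hr]

end IntRow

/-- Depth-first search through the self-avoiding walks on the `4`-cube from the vertex `v`
that avoid the vertices in the bit mask `visited`, testing at each node that one of the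
transported functionals in `rows` is nonpositive. -/
def allSeparated : ℕ → ℕ → ℕ → List IntRow → Bool
  | 0, _, _, _ => false
  | fuel + 1, v, visited, rows =>
    rows.any IntRow.nonpos && [0, 1, 2, 3].all fun a : Fin 4 =>
      visited.testBit (v ^^^ 2 ^ (a : ℕ)) ||
        allSeparated fuel (v ^^^ 2 ^ (a : ℕ)) (visited ||| 2 ^ (v ^^^ 2 ^ (a : ℕ)))
          (rows.map (IntRow.step · a))

lemma exists_nonpos_of_allSeparated (rows : List IntRow) (l : List (Fin 4)) :
    ∀ (p : List (Fin 4)) (fuel visited : ℕ),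
      allSeparated fuel (cubeVertex p) visited (rows.map (p.foldl IntRow.step)) = true →
      (∀ u, visited.testBit u = true → ∃ j ≤ p.length, u = cubeVertex (p.take j)) →
      IsValidList (p ++ l) →
      ∃ r ∈ rows, ((p ++ l).foldl IntRow.step r).nonpos = true := by
  induction l with
  | nil =>
    intro p fuel visited hsearch _ _
    cases fuel with
    | zero => simp [allSeparated] at hsearch
    | succ fuel =>
      rw [allSeparated, Bool.and_eq_true] at hsearch
      simpa using hsearch.1
  | cons a l ih =>
    intro p fuel visited hsearch hvis hval
    cases fuel with
    | zero => simp [allSeparated] at hsearch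
    | succ fuel =>
      rw [allSeparated, Bool.and_eq_true, List.all_eq_true] at hsearch
      have hmem : a ∈ ([0, 1, 2, 3] : List (Fin 4)) := by fin_cases a <;> simp
      have hnext := hsearch.2 a hmem
      have hvertex : cubeVertex p ^^^ 2 ^ (a : ℕ) = cubeVertex (p ++ [a]) := by
        simp [cubeVertex_append, cubeVertex]
      rw [hvertex, Bool.or_eq_true, List.map_map] at hnext
      have hrows : (IntRow.step · a) ∘ p.foldl IntRow.step =
          (p ++ [a]).foldl IntRow.step := by
        ext1 r
        simp
      rw [hrows] at hnext
      rcases hnext with hnext | hnext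
      · obtain ⟨j, hj, heq⟩ := hvis _ hnext
        exact absurd heq.symm (hval.cubeVertex_take_ne hj)
      · have happ : p ++ a :: l = (p ++ [a]) ++ l := by simp
        rw [happ] at hval ⊢
        refine ih _ fuel _ hnext (fun u hu => ?_) hval
        rw [Nat.testBit_or, Bool.or_eq_true, Nat.testBit_two_pow, decide_eq_true_eq] at hu
        rcases hu with hu | hu
        · obtain ⟨j, hj, rfl⟩ := hvis u hu
          exact ⟨j, by simp; omega, by rw [List.take_append_of_le_length hj]⟩
        · exact ⟨(p ++ [a]).length, le_rfl, by rw [List.take_length, hu]⟩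

/-- Functionals that suffice for all walks starting with the directions `0`, `1`. -/
def separatingRows : List IntRow :=
  [⟨2, 2, 1, 0⟩, ⟨2, 2, 0, 1⟩, ⟨1, 0, 0, 0⟩, ⟨0, 1, 0, 0⟩]

lemma allSeparated_separatingRows :
    allSeparated 14 (cubeVertex [0, 1]) 11 (separatingRows.map ([0, 1].foldl IntRow.step)) =
      true := by
  decide +kernel

lemma isSeparated_zero_one_append {l : List (Fin 4)} (hval : IsValidList ([0, 1] ++ l)) :
    IsSeparated ([0, 1] ++ l) := by
  obtain ⟨r, hr, hnonpos⟩ := exists_nonpos_of_allSeparated separatingRows l [0, 1] 14 11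
    allSeparated_separatingRows (fun u hu => by
      have hlt : u < 4 := by
        by_contra! hge
        have : Nat.testBit 11 u = false :=
          Nat.testBit_lt_two_pow (lt_of_lt_of_le (by norm_num) (Nat.pow_le_pow_right two_pos hge))
        simp [this] at hu
      interval_cases u
      · exact ⟨0, by simp, rfl⟩
      · exact ⟨1, by simp, rfl⟩
      · exact absurd hu (by decide)
      · exact ⟨2, by simp, rfl⟩) hval
  have hstart : ∀ s ∈ separatingRows, (∀ i, 0 ≤ s.toFun i) ∧ ∃ i, 0 < s.toFun i := by
    simp only [separatingRows, List.forall_mem_cons]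
    decide
  refine ⟨r.toFun, (hstart r hr).1, (hstart r hr).2, fun i => ?_⟩
  rw [← IntRow.toFun_foldl_step]
  exact IntRow.toFun_nonpos hnonpos i

lemma isSeparated_singleton (a : Fin 4) : IsSeparated [a] :=
  ⟨Pi.single a 1, by revert a; decide, ⟨a, by simp⟩, by revert a; decide⟩

lemma exists_perm_map_zero_one {a b : Fin 4} (hab : a ≠ b) :
    ∃ σ : Equiv.Perm (Fin 4), σ a = 0 ∧ σ b = 1 := by
  revert a b
  decide

lemma IsValidList.isSeparated {l : List (Fin 4)} (hne : l ≠ []) (hval : IsValidList l) :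
    IsSeparated l := by
  match l, hne, hval with
  | [a], _, _ => exact isSeparated_singleton a
  | a :: b :: l, _, hval =>
    have hab : a ≠ b := by
      rintro rfl
      refine hval 0 2 two_pos (by simp) fun m => ?_
      by_cases h : a = m <;> simp [h]
    obtain ⟨σ, ha, hb⟩ := exists_perm_map_zero_one hab
    refine IsSeparated.of_map (σ := σ) ?_
    have hmap := hval.map σ
    rw [List.map_cons, List.map_cons, ha, hb] at hmap ⊢
    exact isSeparated_zero_one_append hmap

/-- The geometric core of the all-net theorem for the 4-orthoplex: for every nonempty valid
list over `{1,2,3,4}`, the open standard simplex (columns of the identity) is disjoint from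
the open simplex on the columns of `N_k = M_{a₁} ⋯ M_{a_k}`; i.e., the first and last facets
of any chain in any ridge unfolding of the 4-orthoplex do not overlap. -/
theorem four_orthoplex_all_net (l : List (Fin 4)) (hne : l ≠ []) (hval : IsValidList l) :
    Disjoint (openSimplexOf (1 : Matrix (Fin 4) (Fin 4) ℝ))
      (openSimplexOf ((l.map reflMat4).prod)) := by
  exact (hval.isSeparated hne).disjoint
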